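/- arXiv:2406.16661 — 2 statements merged into one kernel-verified Lean document; each statement's English description precedes it below -/
import Mathlib

section
/- Let X and Y be independent random points, each uniformly distributed on [0,1]². Then the expected Euclidean distance satisfies 1/3 ≤ E[‖X − Y‖₂] ≤ 1/√3. -/
open MeasureTheory ProbabilityTheory

/-- The unit square `[0,1]² ⊆ ℝ²` (with the Euclidean norm on `ℝ²`). -/
def unitSquare : Set (EuclideanSpace ℝ (Fin 2)) := {x | ∀ i, x i ∈ Set.Icc (0 : ℝ) 1}

/-- The coordinates of a uniform point of the unit square are uniform on `[0, 1]`. -/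
lemma map_apply_restrict_unitSquare (i : Fin 2) :
    Measure.map (fun x : EuclideanSpace ℝ (Fin 2) => x i) (volume.restrict unitSquare) =
      volume.restrict (Set.Icc (0 : ℝ) 1) := by
  have h_pre : unitSquare = (WithLp.ofLp : EuclideanSpace ℝ (Fin 2) → Fin 2 → ℝ) ⁻¹'
      Set.pi Set.univ (fun _ => Set.Icc (0 : ℝ) 1) := by
    ext x
    simp only [unitSquare, Set.mem_ofPred_eq, Set.mem_preimage, Set.mem_univ_pi]
  have h_ofLp := (PiLp.volume_preserving_ofLp (Fin 2)).restrict_preimage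
    (s := Set.pi Set.univ (fun _ : Fin 2 => Set.Icc (0 : ℝ) 1))
    (MeasurableSet.univ_pi fun _ => measurableSet_Icc)
  have : IsProbabilityMeasure (volume.restrict (Set.Icc (0 : ℝ) 1)) := ⟨by simp⟩
  rw [volume_pi, Measure.restrict_pi_pi, ← h_pre] at h_ofLp
  exact ((measurePreserving_eval (fun _ : Fin 2 => volume.restrict (Set.Icc (0 : ℝ) 1)) i).comp
    h_ofLp).map_eq

/-- Continuous functions of two independent uniform variables on `[0, 1]` are integrable, and
their expectation is a double integral. -/
lemma integral_comp_of_indepFun_uniform {Ω : Type*} [MeasurableSpace Ω] {μ : Measure Ω}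
    [IsProbabilityMeasure μ] {U V : Ω → ℝ} (hU : Measurable U) (hV : Measurable V)
    (hindep : IndepFun U V μ)
    (hUu : Measure.map U μ = volume.restrict (Set.Icc (0 : ℝ) 1))
    (hVu : Measure.map V μ = volume.restrict (Set.Icc (0 : ℝ) 1))
    {f : ℝ → ℝ → ℝ} (hf : Continuous fun p : ℝ × ℝ => f p.1 p.2) :
    Integrable (fun ω => f (U ω) (V ω)) μ ∧
      ∫ ω, f (U ω) (V ω) ∂μ = ∫ x in (0 : ℝ)..1, ∫ y in (0 : ℝ)..1, f x y := by
  have h_map := (indepFun_iff_map_prod_eq_prod_map_map hU.aemeasurable hV.aemeasurable).1 hindep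
  rw [hUu, hVu] at h_map
  have h_int : Integrable (fun p : ℝ × ℝ => f p.1 p.2)
      ((volume.restrict (Set.Icc (0 : ℝ) 1)).prod (volume.restrict (Set.Icc (0 : ℝ) 1))) := by
    rw [Measure.prod_restrict]
    exact hf.continuousOn.integrableOn_compact (isCompact_Icc.prod isCompact_Icc)
  have h_UV : Measurable fun ω => (U ω, V ω) := hU.prodMk hV
  constructor
  · rw [← h_map] at h_int
    exact h_int.comp_measurable h_UV
  · have h_eq := integral_map h_UV.aemeasurable (f := fun p : ℝ × ℝ => f p.1 p.2)
      (μ := μ) hf.aestronglyMeasurable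
    rw [← h_eq, h_map, integral_prod _ h_int]
    simp only [intervalIntegral.integral_of_le zero_le_one, integral_Icc_eq_integral_Ioc]

lemma integral_integral_sub_sq :
    ∫ x in (0 : ℝ)..1, ∫ y in (0 : ℝ)..1, (x - y) ^ 2 = 1 / 6 := by
  have h_inner (x : ℝ) : ∫ y in (0 : ℝ)..1, (x - y) ^ 2 = x ^ 2 - x + 1 / 3 := by
    rw [intervalIntegral.integral_comp_sub_left (fun z => z ^ 2), integral_pow]
    push_cast
    ring
  simp_rw [h_inner]
  rw [intervalIntegral.integral_add, intervalIntegral.integral_sub, integral_pow, integral_id]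
  · norm_num
  all_goals exact Continuous.intervalIntegrable (by fun_prop) _ _

lemma integral_integral_abs_sub :
    ∫ x in (0 : ℝ)..1, ∫ y in (0 : ℝ)..1, |x - y| = 1 / 3 := by
  have h_inner : ∀ x ∈ Set.uIcc (0 : ℝ) 1,
      ∫ y in (0 : ℝ)..1, |x - y| = x ^ 2 - x + 1 / 2 := by
    intro x hx
    rw [Set.uIcc_of_le zero_le_one] at hx
    have h_cont : Continuous fun y => |x - y| := by fun_prop
    have h_left : ∫ y in (0 : ℝ)..x, |x - y| = ∫ y in (0 : ℝ)..x, (x - y) := by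
      refine intervalIntegral.integral_congr fun y hy => ?_
      rw [Set.uIcc_of_le hx.1] at hy
      exact abs_of_nonneg (sub_nonneg.2 hy.2)
    have h_right : ∫ y in x..1, |x - y| = ∫ y in x..1, (y - x) := by
      refine intervalIntegral.integral_congr fun y hy => ?_
      rw [Set.uIcc_of_le hx.2] at hy
      exact (abs_of_nonpos (sub_nonpos.2 hy.1)).trans (neg_sub x y)
    rw [← intervalIntegral.integral_add_adjacent_intervals (h_cont.intervalIntegrable 0 x)
      (h_cont.intervalIntegrable x 1), h_left, h_right,
      intervalIntegral.integral_comp_sub_left (fun z => z),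
      intervalIntegral.integral_comp_sub_right (fun z => z), integral_id, integral_id]
    ring
  rw [intervalIntegral.integral_congr h_inner,
    intervalIntegral.integral_add, intervalIntegral.integral_sub, integral_pow, integral_id]
  · norm_num
  all_goals exact Continuous.intervalIntegrable (by fun_prop) _ _

/-- For independent uniform points `X, Y` of the unit square, the expected
Euclidean distance satisfies `1/3 ≤ E[‖X − Y‖] ≤ 1/√3`. -/
theorem expected_distance_uniform_unit_square {Ω : Type*} [MeasureSpace Ω]
    [IsProbabilityMeasure (ℙ : Measure Ω)]
    (X Y : Ω → EuclideanSpace ℝ (Fin 2)) (hX : Measurable X) (hY : Measurable Y)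
    (hindep : IndepFun X Y ℙ)
    (hXu : Measure.map X ℙ = volume.restrict unitSquare)
    (hYu : Measure.map Y ℙ = volume.restrict unitSquare) :
    1 / 3 ≤ (∫ ω, dist (X ω) (Y ω)) ∧ (∫ ω, dist (X ω) (Y ω)) ≤ 1 / Real.sqrt 3 := by
  have h_meas (i : Fin 2) : Measurable fun x : EuclideanSpace ℝ (Fin 2) => x i := by fun_prop
  have h_coord {f : ℝ → ℝ → ℝ} (hf : Continuous fun p : ℝ × ℝ => f p.1 p.2) (i : Fin 2) :=
    integral_comp_of_indepFun_uniform ((h_meas i).comp hX) ((h_meas i).comp hY)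
      (hindep.comp (h_meas i) (h_meas i))
      (by rw [← Measure.map_map (h_meas i) hX, hXu, map_apply_restrict_unitSquare])
      (by rw [← Measure.map_map (h_meas i) hY, hYu, map_apply_restrict_unitSquare]) hf
  have h_abs := h_coord (f := fun x y => |x - y|) (by fun_prop) 0
  have h_sq := h_coord (f := fun x y => (x - y) ^ 2) (by fun_prop)
  rw [integral_integral_abs_sub] at h_abs
  rw [integral_integral_sub_sq] at h_sq
  simp only [Function.comp_apply] at h_abs h_sq
  have h_dist_sq (ω : Ω) :
      dist (X ω) (Y ω) ^ 2 = (X ω 0 - Y ω 0) ^ 2 + (X ω 1 - Y ω 1) ^ 2 := by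
    rw [EuclideanSpace.dist_eq, Real.sq_sqrt (by positivity)]
    simp [Fin.sum_univ_two, Real.dist_eq]
  have h_int_sq : Integrable (fun ω => dist (X ω) (Y ω) ^ 2) ℙ := by
    simp_rw [h_dist_sq]
    exact (h_sq 0).1.add (h_sq 1).1
  have h_integral_sq : ∫ ω, dist (X ω) (Y ω) ^ 2 = 1 / 3 := by
    simp_rw [h_dist_sq]
    rw [integral_add (h_sq 0).1 (h_sq 1).1, (h_sq 0).2, (h_sq 1).2]
    norm_num
  have h_sqrt : 0 < Real.sqrt 3 := by positivity
  have h_sqrt_sq : Real.sqrt 3 ^ 2 = 3 := Real.sq_sqrt (by norm_num)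
  have h_upper (ω : Ω) :
      dist (X ω) (Y ω) ≤ Real.sqrt 3 / 2 * dist (X ω) (Y ω) ^ 2 + Real.sqrt 3 / 6 := by
    nlinarith [mul_nonneg h_sqrt.le (sq_nonneg (dist (X ω) (Y ω) - Real.sqrt 3 / 3))]
  have h_int_upper : Integrable
      (fun ω => Real.sqrt 3 / 2 * dist (X ω) (Y ω) ^ 2 + Real.sqrt 3 / 6) ℙ :=
    (h_int_sq.const_mul _).add (integrable_const _)
  have h_int : Integrable (fun ω => dist (X ω) (Y ω)) ℙ :=
    h_int_upper.mono' (hX.dist hY).aestronglyMeasurable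
      (ae_of_all _ fun ω => by simpa [abs_of_nonneg] using h_upper ω)
  constructor
  · rw [← h_abs.2]
    refine integral_mono h_abs.1 h_int fun ω => abs_le_of_sq_le_sq ?_ dist_nonneg
    rw [h_dist_sq]
    exact le_add_of_nonneg_right (sq_nonneg _)
  · refine (integral_mono h_int h_int_upper h_upper).trans_eq ?_
    rw [integral_add (h_int_sq.const_mul _) (integrable_const _), integral_const_mul,
      h_integral_sq, integral_const, probReal_univ, one_smul, eq_div_iff h_sqrt.ne']
    linarith
end

section
/- Let r > 0 and let w, F, w' be points of the Euclidean plane ℝ² with ‖F − w‖₂ ≥ r/2. Let e = (F − w)/‖F − w‖₂ be the unit vector from w toward F, let t = ⟨w' − w, e⟩ be the component of w' − w along e, and suppose r/4 ≤ t ≤ 3r/8 and the orthogonal component satisfies ‖(w' − w) − t·e‖₂ ≤ r/8. Then ‖w' − w‖₂ ≤ (√10/8)·r < r/2, and ‖w' − F‖₂ ≤ ‖w − F‖₂ − r/8. -/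
open RealInnerProductSpace

/-- Pythagoras along the line spanned by a unit vector `e`. -/
theorem norm_sub_smul_sq_eq_add_sq {E : Type*} [NormedAddCommGroup E] [InnerProductSpace ℝ E]
    {e : E} (he : ‖e‖ = 1) (u : E) (s : ℝ) :
    ‖u - s • e‖ ^ 2 = ‖u - ⟪u, e⟫ • e‖ ^ 2 + (⟪u, e⟫ - s) ^ 2 := by
  simp only [norm_sub_sq_real, inner_smul_right, norm_smul, he, mul_one, Real.norm_eq_abs, sq_abs]
  ring

/-- **one greedy-routing step.** Let `r > 0` and `w, F, w' ∈ ℝ²` with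
`‖F − w‖ ≥ r/2`. With `e` the unit vector from `w` toward `F` and `t = ⟪w' − w, e⟫`,
suppose `r/4 ≤ t ≤ 3r/8` and the orthogonal component of `w' − w` has norm at most `r/8`.
Then `‖w' − w‖ ≤ (√10/8)·r < r/2` and `‖w' − F‖ ≤ ‖w − F‖ − r/8`. -/
theorem greedy_step_distance_decrease (r : ℝ) (hr : 0 < r)
    (w F w' : EuclideanSpace ℝ (Fin 2)) (hF : r / 2 ≤ ‖F - w‖)
    (e : EuclideanSpace ℝ (Fin 2)) (he : e = ‖F - w‖⁻¹ • (F - w))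
    (t : ℝ) (ht : t = ⟪w' - w, e⟫)
    (ht1 : r / 4 ≤ t) (ht2 : t ≤ 3 * r / 8)
    (horth : ‖(w' - w) - t • e‖ ≤ r / 8) :
    ‖w' - w‖ ≤ Real.sqrt 10 / 8 * r ∧ Real.sqrt 10 / 8 * r < r / 2 ∧
      ‖w' - F‖ ≤ ‖w - F‖ - r / 8 := by
  have hD : 0 < ‖F - w‖ := by linarith
  have he1 : ‖e‖ = 1 := by
    rw [he, norm_smul, norm_inv, norm_norm, inv_mul_cancel₀ hD.ne']
  have hFe : F - w = ‖F - w‖ • e := by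
    rw [he, smul_smul, mul_inv_cancel₀ hD.ne', one_smul]
  have hp : ‖(w' - w) - t • e‖ ^ 2 ≤ (r / 8) ^ 2 := by gcongr
  have hstep : ‖w' - w‖ ^ 2 = ‖(w' - w) - t • e‖ ^ 2 + t ^ 2 := by
    simpa [← ht] using norm_sub_smul_sq_eq_add_sq he1 (w' - w) 0
  have hdist : ‖w' - F‖ ^ 2 = ‖(w' - w) - t • e‖ ^ 2 + (t - ‖F - w‖) ^ 2 := by
    have h := norm_sub_smul_sq_eq_add_sq he1 (w' - w) ‖F - w‖
    rwa [← hFe, sub_sub_sub_cancel_right, ← ht] at h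
  have h10 : Real.sqrt 10 ^ 2 = 10 := Real.sq_sqrt (by norm_num)
  refine ⟨?_, ?_, ?_⟩
  · refine (abs_le_of_sq_le_sq' ?_ (by positivity)).2
    rw [hstep, mul_pow, div_pow, h10]
    nlinarith
  · have h4 : Real.sqrt 10 < 4 := by
      rw [Real.sqrt_lt' (by norm_num)]
      norm_num
    nlinarith
  · rw [norm_sub_rev w F]
    refine (abs_le_of_sq_le_sq' ?_ (by linarith)).2
    have hmul : 0 ≤ (‖F - w‖ - r / 2) * (2 * t - r / 4) :=
      mul_nonneg (by linarith) (by linarith)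
    have hquad : 0 ≤ (t - r / 4) * (3 * r / 8 - t) :=
      mul_nonneg (by linarith) (by linarith)
    rw [hdist]
    nlinarith
end
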